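/- The pushforward of the probability measure m̂ under the second projection p₂ : Ω → X⁻¹O ∩ ᶜK, (ξ₋,ξ₊) ↦ ξ₊, equals q times the restriction of the Haar measure μ to X⁻¹O ∩ ᶜK: (p₂)_* m̂ = q · μ|_{X⁻¹O ∩ ᶜK}. -/

import Mathlib

open MeasureTheory
open scoped ENNReal Classical

noncomputable section

namespace ArtinCoding

variable (k : Type*) [Field k] [Fintype k]

/-- The field `K̂ = k((X⁻¹))` of formal Laurent series in `X⁻¹` over `k`, realized as the
field of formal Laurent series `k((t))` in the variable `t = X⁻¹`. -/
abbrev Khat := LaurentSeries k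

variable {k}

/-- The absolute value `|f|_∞ = q^{-v_∞(f)}`, where `v_∞` is the order of vanishing in the
variable `t = X⁻¹` (so a nonzero polynomial in `X` has absolute value `≥ 1`). -/
def absInf (f : Khat k) : ℝ :=
  if f = 0 then 0 else (Fintype.card k : ℝ) ^ (-f.order)

lemma absInf_nonneg (f : Khat k) : 0 ≤ absInf f := by
  unfold absInf
  split
  · exact le_refl 0
  · positivity

lemma absInf_eq_zero {f : Khat k} : absInf f = 0 ↔ f = 0 := by
  constructor
  · intro h
    by_contra hf
    have hq : (0:ℝ) < (Fintype.card k : ℝ) := by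
      have := Fintype.card_pos (α := k); positivity
    rw [absInf, if_neg hf] at h
    exact absurd h (ne_of_gt (zpow_pos hq _))
  · intro h; simp [absInf, h]

lemma absInf_neg (f : Khat k) : absInf (-f) = absInf f := by
  unfold absInf
  rw [neg_eq_zero, HahnSeries.order_neg]

lemma absInf_add_le (f g : Khat k) : absInf (f + g) ≤ max (absInf f) (absInf g) := by
  rcases eq_or_ne (f + g) 0 with h | h
  · rw [show absInf (f+g) = 0 by rw [absInf_eq_zero]; exact h]
    exact le_max_of_le_left (absInf_nonneg f)
  rcases eq_or_ne f 0 with hf | hf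
  · simp [hf]
  rcases eq_or_ne g 0 with hg | hg
  · simp [hg]
  have hmin := HahnSeries.min_order_le_order_add h
  have hq : (1:ℝ) ≤ (Fintype.card k : ℝ) := by
    exact_mod_cast Nat.one_le_iff_ne_zero.mpr Fintype.card_ne_zero
  rw [absInf, if_neg h]
  rcases le_total f.order g.order with hod | hod
  · rw [min_eq_left hod] at hmin
    refine le_max_of_le_left ?_
    rw [absInf, if_neg hf]
    exact zpow_le_zpow_right₀ hq (neg_le_neg hmin)
  · rw [min_eq_right hod] at hmin
    refine le_max_of_le_right ?_
    rw [absInf, if_neg hg]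
    exact zpow_le_zpow_right₀ hq (neg_le_neg hmin)

/-- The metric `d_∞(f,g) = |f-g|_∞` on `K̂`. -/
noncomputable instance : MetricSpace (Khat k) where
  dist f g := absInf (f - g)
  dist_self f := by simp [absInf]
  dist_comm f g := by
    have : g - f = -(f - g) := by ring
    show absInf (f - g) = absInf (g - f)
    rw [this, absInf_neg]
  dist_triangle f g h := by
    show absInf (f - h) ≤ absInf (f - g) + absInf (g - h)
    have key : absInf (f - h) ≤ max (absInf (f - g)) (absInf (g - h)) := by
      have : f - h = (f - g) + (g - h) := by ring
      rw [this]; exact absInf_add_le _ _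
    exact key.trans (max_le_add_of_nonneg (absInf_nonneg _) (absInf_nonneg _))
  eq_of_dist_eq_zero := by
    intro f g h
    have : f - g = 0 := absInf_eq_zero.mp h
    exact sub_eq_zero.mp this

/- Make sure the topology coming from the metric `d_∞` is the one used everywhere
(the valued-field uniformity on Laurent series induces the same topology). -/
instance (priority := 10000) : UniformSpace (Khat k) := PseudoMetricSpace.toUniformSpace
instance (priority := 10000) : TopologicalSpace (Khat k) := UniformSpace.toTopologicalSpace

instance : MeasurableSpace (Khat k) := borel _
instance : BorelSpace (Khat k) := ⟨rfl⟩

variable (k)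

/-- The element `X⁻¹` of `K̂` (the uniformizer `t`). -/
def Xinv : Khat k := HahnSeries.single (1 : ℤ) (1 : k)

/-- The element `X` of `K̂`. -/
def Xel : Khat k := HahnSeries.single (-1 : ℤ) (1 : k)

/-- The valuation ring `O = k[[X⁻¹]] = {f : |f|_∞ ≤ 1}`. -/
def Oball : Set (Khat k) := {f | absInf f ≤ 1}

/-- The set `X⁻¹O`, i.e. the maximal ideal of `O`. -/
def XinvO : Set (Khat k) := (fun f => Xinv k * f) '' Oball k

/-- The ring `A = k[X]` of polynomials in `X`, viewed as a subset of `K̂`. -/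
def Aset : Set (Khat k) := Set.range fun p : Polynomial k => Polynomial.aeval (Xel k) p

/-- The constants `k ⊆ K̂`. -/
def kconsts : Set (Khat k) := Set.range (algebraMap k (Khat k))

/-- The set `A∖k` of nonconstant polynomials in `X`, viewed inside `K̂`. -/
def AmK : Set (Khat k) := Aset k \ kconsts k

/-- The field `K = k(X)` of rational functions, viewed as a subset of `K̂`
(note that `k(X) = k(X⁻¹)` as a subfield of `K̂`). -/
def Kset : Set (Khat k) := Set.range fun r : RatFunc k => (r : LaurentSeries k)

/-- The set `ᶜK = K̂ ∖ K` of irrational elements. -/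
def cK : Set (Khat k) := (Kset k)ᶜ

variable {k}

/-- The integer part `[f] ∈ A = k[X]` of `f ∈ K̂`: the sum of the terms of `f` with
nonpositive exponents in `t = X⁻¹`. -/
def intPart (f : Khat k) : Khat k :=
  ∑ i ∈ Finset.Icc (min f.order 0) 0, HahnSeries.single i (f.coeff i)

/-- The fractional part `{f} = f - [f] ∈ X⁻¹O` of `f ∈ K̂`. -/
def fracPart (f : Khat k) : Khat k := f - intPart f

/-- The Artin map `Ψ(f) = 1/f - [1/f]`. -/
def ArtinPsi (f : Khat k) : Khat k := fracPart f⁻¹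

/-- The Artin continued fraction digit `a_{n+1}(f) = [1/Ψⁿ(f)]` (for `n : ℕ`, so that
`digit 0 f = a₁(f) = [1/f]`). -/
def digit (n : ℕ) (f : Khat k) : Khat k := intPart ((ArtinPsi (k := k))^[n] f)⁻¹

variable (k)

/-- The set `J = ⋃_{a ∈ A∖k} (a + X⁻¹O)`. -/
def Jset : Set (Khat k) := ⋃ a ∈ AmK k, (fun x => a + x) '' XinvO k

/-- The domain `Ω = (J ∩ ᶜK) × (X⁻¹O ∩ ᶜK)` of the natural extension of the Artin map. -/
def OmegaSet : Set (Khat k × Khat k) := (Jset k ∩ cK k) ×ˢ (XinvO k ∩ cK k)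

variable {k}

/-- The map `Φ(ξ₋, ξ₊) = (1/ξ₋ - [1/ξ₊], Ψ(ξ₊))` (as a globally defined map on `K̂ × K̂`). -/
def PhiRaw (p : Khat k × Khat k) : Khat k × Khat k :=
  (p.1⁻¹ - intPart p.2⁻¹, ArtinPsi p.2)

/-- The coding map `Θ'` sending `(ξ₋, ξ₊)` to the bilateral sequence `(c_n)_{n ∈ ℤ}` with
`c_n = a_n(ξ₊)` for `n ≥ 1` and `c_{-n} = a_{n+1}(-1/ξ₋)` for `n ≥ 0`. -/
def ThetaRaw (p : Khat k × Khat k) : ℤ → Khat k := fun n =>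
  if 1 ≤ n then digit (n - 1).toNat p.2 else digit (-n).toNat (-p.1⁻¹)

variable (k)

/-- The density `q²/|ξ₊ - ξ₋|²_∞`. -/
def dens (p : Khat k × Khat k) : ℝ≥0∞ :=
  ENNReal.ofReal ((Fintype.card k : ℝ) ^ 2 * ((absInf (p.2 - p.1)) ^ 2)⁻¹)

/-- The measure `m̂` on `Ω` given by `dm̂(ξ₋,ξ₊) = q² dμ(ξ₋) dμ(ξ₊)/|ξ₊ - ξ₋|²_∞`. -/
def mhat (μ : Measure (Khat k)) : Measure (Khat k × Khat k) :=
  (((μ.prod μ).withDensity (dens k))).restrict (OmegaSet k)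

/-- The weight `ν(a) = |a|_∞⁻² = q^{-2 deg a}` for `a ∈ A∖k` (and `0` otherwise),
with values in `ℝ≥0∞`. -/
def nuE (a : Khat k) : ℝ≥0∞ :=
  if a ∈ AmK k then ENNReal.ofReal (((absInf a) ^ 2)⁻¹) else 0

variable {k}

/-- The fractional ideal `X⁻ⁿO`, i.e. the elements whose expansion in `X⁻¹` starts in degree
at least `n`. -/
def idealPow (n : ℤ) : Set (Khat k) := {f | ∀ i < n, f.coeff i = 0}

lemma one_lt_card : (1 : ℝ) < Fintype.card k := by
  exact_mod_cast Fintype.one_lt_card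

lemma absInf_of_ne_zero {f : Khat k} (hf : f ≠ 0) :
    absInf f = (Fintype.card k : ℝ) ^ (-f.order) := by
  rw [absInf, if_neg hf]

lemma absInf_le_zpow_iff {f : Khat k} {n : ℤ} :
    absInf f ≤ (Fintype.card k : ℝ) ^ (-n) ↔ f ∈ idealPow n := by
  rcases eq_or_ne f 0 with rfl | hf
  · simp only [idealPow, Set.mem_ofPred_eq, HahnSeries.coeff_zero, implies_true, iff_true]
    rw [absInf_eq_zero.mpr rfl]
    positivity
  · rw [absInf_of_ne_zero hf, zpow_le_zpow_iff_right₀ one_lt_card, neg_le_neg_iff,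
      HahnSeries.le_order_iff_forall hf]
    rfl

lemma idealPow_eq_closedBall (n : ℤ) :
    (idealPow n : Set (Khat k)) = Metric.closedBall 0 ((Fintype.card k : ℝ) ^ (-n)) := by
  ext f
  rw [Metric.mem_closedBall, ← absInf_le_zpow_iff]
  change _ ↔ absInf (f - 0) ≤ _
  rw [sub_zero]

lemma measurableSet_idealPow (n : ℤ) : MeasurableSet (idealPow n : Set (Khat k)) := by
  rw [idealPow_eq_closedBall]
  exact Metric.isClosed_closedBall.measurableSet

omit [Fintype k] in
lemma idealPow_antitone : Antitone (idealPow : ℤ → Set (Khat k)) :=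
  fun _ _ hmn _ hf i hi => hf i (hi.trans_le hmn)

omit [Fintype k] in
lemma add_mem_idealPow {n : ℤ} {f g : Khat k} (hf : f ∈ idealPow n) (hg : g ∈ idealPow n) :
    f + g ∈ idealPow n := fun i hi => by
  rw [HahnSeries.coeff_add, hf i hi, hg i hi, add_zero]

omit [Fintype k] in
lemma sub_mem_idealPow {n : ℤ} {f g : Khat k} (hf : f ∈ idealPow n) (hg : g ∈ idealPow n) :
    f - g ∈ idealPow n := fun i hi => by
  rw [HahnSeries.coeff_sub, hf i hi, hg i hi, sub_zero]

omit [Fintype k] in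
lemma iUnion_idealPow_neg : (⋃ n : ℕ, idealPow (-n : ℤ) : Set (Khat k)) = Set.univ := by
  refine Set.eq_univ_of_forall fun f => Set.mem_iUnion.mpr ⟨(-f.order).toNat, fun i hi => ?_⟩
  exact HahnSeries.coeff_eq_zero_of_lt_order (by omega)

lemma Oball_eq : Oball k = idealPow 0 := by
  ext f
  rw [← absInf_le_zpow_iff]
  simp [Oball]

lemma XinvO_eq : XinvO k = idealPow 1 := by
  have hcoeff : ∀ (g : Khat k) (i : ℤ), (Xinv k * g).coeff i = g.coeff (i - 1) := fun g i => by
    have := HahnSeries.coeff_single_mul_add (r := (1 : k)) (x := g) (a := i - 1) (b := 1)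
    simpa [Xinv] using this
  rw [XinvO, Oball_eq]
  ext f
  constructor
  · rintro ⟨g, hg, rfl⟩ i hi
    change (Xinv k * g).coeff i = 0
    rw [hcoeff]
    exact hg _ (by omega)
  · intro hf
    have hX : Xinv k * Xel k = 1 := by
      rw [Xinv, Xel, HahnSeries.single_mul_single]
      simp
    refine ⟨Xel k * f, fun i hi => ?_, ?_⟩
    · have := hcoeff (Xel k * f) (i + 1)
      rw [← mul_assoc, hX, one_mul, add_sub_cancel_right] at this
      rw [← this]
      exact hf _ (by omega)
    · change Xinv k * (Xel k * f) = f
      rw [← mul_assoc, hX, one_mul]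

omit [Fintype k] in
lemma aeval_Xel (p : Polynomial k) :
    Polynomial.aeval (Xel k) p
      = ∑ i ∈ Finset.range (p.natDegree + 1), HahnSeries.single (-i : ℤ) (p.coeff i) := by
  rw [Polynomial.aeval_eq_sum_range]
  refine Finset.sum_congr rfl fun i _ => ?_
  rw [Xel, HahnSeries.single_pow, Algebra.smul_def, LaurentSeries.algebraMap_apply, HahnSeries.C_apply,
    HahnSeries.single_mul_single]
  simp

omit [Fintype k] in
lemma coeff_aeval_Xel_neg (p : Polynomial k) (n : ℕ) :
    (Polynomial.aeval (Xel k) p).coeff (-n : ℤ) = p.coeff n := by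
  rw [aeval_Xel, HahnSeries.coeff_sum]
  simp only [HahnSeries.coeff_single, neg_inj, Nat.cast_inj]
  rw [Finset.sum_ite_eq]
  split_ifs with h
  · rfl
  · rw [Polynomial.coeff_eq_zero_of_natDegree_lt]
    simpa [Nat.lt_succ_iff] using h

omit [Fintype k] in
lemma exists_aeval_sub_mem_idealPow (f : Khat k) :
    ∃ p : Polynomial k, f - Polynomial.aeval (Xel k) p ∈ idealPow 1 := by
  let N : ℕ := (-f.order).toNat
  refine ⟨∑ n ∈ Finset.range (N + 1), Polynomial.monomial n (f.coeff (-n : ℤ)), fun i hi => ?_⟩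
  obtain ⟨n, rfl⟩ : ∃ n : ℕ, i = -n := ⟨(-i).toNat, by omega⟩
  rw [HahnSeries.coeff_sub, coeff_aeval_Xel_neg, Polynomial.finsetSum_coeff]
  simp only [Polynomial.coeff_monomial]
  rw [Finset.sum_ite_eq']
  split_ifs with h
  · exact sub_self _
  · rw [sub_zero]
    refine HahnSeries.coeff_eq_zero_of_lt_order ?_
    simp only [Finset.mem_range, N] at h
    omega

omit [Fintype k] in
lemma aeval_mem_kconsts_iff {p : Polynomial k} :
    Polynomial.aeval (Xel k) p ∈ kconsts k ↔ Polynomial.aeval (Xel k) p ∈ idealPow 0 := by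
  constructor
  · rintro ⟨c, hc⟩ i hi
    rw [← hc, LaurentSeries.algebraMap_apply, HahnSeries.C_apply, HahnSeries.coeff_single_of_ne hi.ne]
  · intro h
    refine ⟨p.coeff 0, ?_⟩
    have hp : p = Polynomial.C (p.coeff 0) := by
      refine Polynomial.eq_C_of_natDegree_eq_zero ?_
      by_contra hne
      refine hne (Polynomial.natDegree_eq_zero.mpr ⟨p.coeff 0, ?_⟩)
      ext n
      rw [Polynomial.coeff_C]
      split_ifs with hn
      · rw [hn]
      · rw [← coeff_aeval_Xel_neg, h _ (by omega)]
    conv_rhs => rw [hp, Polynomial.aeval_C]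

lemma Jset_eq : Jset k = (idealPow 0)ᶜ := by
  have hle : (idealPow 1 : Set (Khat k)) ⊆ idealPow 0 := idealPow_antitone zero_le_one
  ext f
  simp only [Jset, Set.mem_iUnion, XinvO_eq, Set.mem_compl_iff]
  constructor
  · rintro ⟨_, ⟨⟨p, rfl⟩, hp⟩, x, hx, rfl⟩ hf
    refine hp (aeval_mem_kconsts_iff.mpr ?_)
    have := sub_mem_idealPow hf (hle hx)
    simpa using this
  · intro hf
    obtain ⟨p, hp⟩ := exists_aeval_sub_mem_idealPow f
    refine ⟨_, ⟨⟨p, rfl⟩, fun h => hf ?_⟩, _, hp, add_sub_cancel _ _⟩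
    have := add_mem_idealPow (aeval_mem_kconsts_iff.mp h) (hle hp)
    simpa using this

variable (k) in
lemma countable_Kset : (Kset k).Countable := by
  have hpoly : Countable (Polynomial k) := by
    rw [← Cardinal.mk_le_aleph0_iff]
    exact Polynomial.cardinalMk_le_max.trans (by simp)
  have : Countable (RatFunc k) := by
    rw [← Cardinal.mk_le_aleph0_iff]
    exact (IsLocalization.cardinalMk_le (R := Polynomial k) (nonZeroDivisors _)).trans
      (Cardinal.mk_le_aleph0_iff.mpr hpoly)
  exact Set.countable_range _

lemma measurableSet_cK : MeasurableSet (cK k) :=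
  (countable_Kset k).measurableSet.compl

lemma absInf_eq_dist (f : Khat k) : absInf f = dist f 0 := by
  change _ = absInf (f - 0)
  rw [sub_zero]

lemma measurable_absInf : Measurable (absInf : Khat k → ℝ) := by
  have h : (absInf : Khat k → ℝ) = fun f => dist f 0 := funext absInf_eq_dist
  rw [h]
  exact (continuous_id.dist continuous_const).measurable

lemma measurable_const_add (x : Khat k) : Measurable fun y : Khat k => x + y := by
  have : Isometry fun y : Khat k => x + y := Isometry.of_dist_eq fun f g => by
    change absInf (x + f - (x + g)) = absInf (f - g)
    rw [add_sub_add_left_eq_sub]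
  exact this.continuous.measurable

section Measure

variable {μ : Measure (Khat k)}

lemma measure_translate (hinv : ∀ x : Khat k, Measure.map (fun y => x + y) μ = μ)
    (x : Khat k) {s : Set (Khat k)} (hs : MeasurableSet s) :
    μ {y | x + y ∈ s} = μ s := by
  conv_rhs => rw [← hinv x, Measure.map_apply (measurable_const_add x) hs]
  rfl

lemma measure_idealPow_succ (hinv : ∀ x : Khat k, Measure.map (fun y => x + y) μ = μ) (n : ℤ) :
    μ (idealPow n) = Fintype.card k * μ (idealPow (n + 1)) := by
  let s : k → Set (Khat k) := fun c => {y | HahnSeries.single n (-c) + y ∈ idealPow (n + 1)}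
  have hmem : ∀ c y, y ∈ s c ↔ y ∈ idealPow n ∧ y.coeff n = c := by
    intro c y
    have hco : ∀ i, (HahnSeries.single n (-c) + y).coeff i = (if i = n then -c else 0) + y.coeff i :=
      fun i => by
        rw [HahnSeries.coeff_add, HahnSeries.coeff_single]
        congr
    constructor
    · intro h
      refine ⟨fun i hi => ?_, ?_⟩
      · have := h i (by omega)
        rwa [hco, if_neg hi.ne, zero_add] at this
      · have := h n (by omega)
        rw [hco, if_pos rfl] at this
        exact (neg_add_eq_zero.mp this).symm
    · rintro ⟨h, rfl⟩ i hi
      rw [hco]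
      split_ifs with hin
      · rw [hin, neg_add_cancel]
      · rw [zero_add, h i (by omega)]
  have hunion : (idealPow n : Set (Khat k)) = ⋃ c, s c := by
    ext y
    simp [hmem]
  rw [hunion, measure_iUnion]
  · rw [tsum_congr fun c => measure_translate hinv _ (measurableSet_idealPow (n + 1)), tsum_fintype]
    simp
  · intro c d hcd
    refine Set.disjoint_left.mpr fun y hc hd => hcd ?_
    rw [← ((hmem c y).mp hc).2, ((hmem d y).mp hd).2]
  · exact fun c => measurable_const_add _ (measurableSet_idealPow (n + 1))

lemma card_ne_zero_ennreal : (Fintype.card k : ℝ≥0∞) ≠ 0 := by simp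

lemma measure_idealPow (hinv : ∀ x : Khat k, Measure.map (fun y => x + y) μ = μ)
    (hO : μ (Oball k) = 1) (n : ℤ) :
    μ (idealPow n) = (Fintype.card k : ℝ≥0∞) ^ (-n) := by
  have hq := card_ne_zero_ennreal (k := k)
  have hq' : (Fintype.card k : ℝ≥0∞) ≠ ∞ := ENNReal.natCast_ne_top _
  induction n using Int.induction_on with
  | zero => simpa [Oball_eq] using hO
  | succ n ih =>
    rw [measure_idealPow_succ hinv] at ih
    refine (ENNReal.mul_right_inj hq hq').mp ?_
    rw [ih, neg_add, ENNReal.zpow_add hq hq', mul_left_comm, zpow_neg_one,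
      ENNReal.mul_inv_cancel hq hq', mul_one]
  | pred n ih =>
    rw [measure_idealPow_succ hinv, sub_add_cancel, ih, neg_sub, sub_eq_add_neg,
      ENNReal.zpow_add hq hq', zpow_one]

lemma sigmaFinite_of_translation_invariant
    (hinv : ∀ x : Khat k, Measure.map (fun y => x + y) μ = μ)
    (hO : μ (Oball k) = 1) : SigmaFinite μ :=
  ⟨⟨{ set := fun n => idealPow (-n : ℤ)
      set_mem := fun _ => trivial
      finite := fun n => by
        rw [measure_idealPow hinv hO]
        exact ENNReal.zpow_lt_top card_ne_zero_ennreal (ENNReal.natCast_ne_top _) _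
      spanning := iUnion_idealPow_neg }⟩⟩

lemma measure_singleton_eq_zero (hinv : ∀ x : Khat k, Measure.map (fun y => x + y) μ = μ)
    (hO : μ (Oball k) = 1) (x : Khat k) : μ {x} = 0 := by
  have hx : μ {x} = μ {0} := by
    rw [← measure_translate hinv x (measurableSet_singleton x)]
    congr 1
    ext y
    simp
  rw [hx]
  have hlt : (Fintype.card k : ℝ≥0∞)⁻¹ < 1 := by
    rw [ENNReal.inv_lt_one]
    exact_mod_cast Fintype.one_lt_card
  refine le_antisymm (ge_of_tendsto' (ENNReal.tendsto_pow_atTop_nhds_zero_of_lt_one hlt)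
    fun n => ?_) zero_le
  calc μ {0} ≤ μ (idealPow (n : ℤ)) :=
        measure_mono (Set.singleton_subset_iff.mpr fun _ _ => HahnSeries.coeff_zero)
    _ = _ := by rw [measure_idealPow hinv hO, ENNReal.zpow_neg, zpow_natCast, ENNReal.inv_pow]

lemma measure_Kset_eq_zero (hinv : ∀ x : Khat k, Measure.map (fun y => x + y) μ = μ)
    (hO : μ (Oball k) = 1) : μ (Kset k) = 0 := by
  rw [← Set.biUnion_of_singleton (Kset k), measure_biUnion_null_iff (countable_Kset k)]
  exact fun x _ => measure_singleton_eq_zero hinv hO x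

/-- The sphere `{|f|_∞ = qⁿ⁺¹}`. -/
def sphere (n : ℕ) : Set (Khat k) := idealPow (-(n + 1) : ℤ) \ idealPow (-n : ℤ)

lemma absInf_eq_of_mem_sphere {n : ℕ} {f : Khat k} (hf : f ∈ sphere n) :
    absInf f = (Fintype.card k : ℝ) ^ (n + 1) := by
  have h0 : f ≠ 0 := by
    rintro rfl
    exact hf.2 fun _ _ => HahnSeries.coeff_zero
  have h1 := hf.1
  have h2 := hf.2
  rw [idealPow, Set.mem_ofPred_eq, ← HahnSeries.le_order_iff_forall h0] at h1 h2
  rw [absInf_of_ne_zero h0, ← zpow_natCast]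
  congr 1
  push_cast
  omega

omit [Fintype k] in
lemma compl_idealPow_zero_eq : ((idealPow 0)ᶜ : Set (Khat k)) = ⋃ n, sphere n := by
  ext f
  rw [Set.mem_compl_iff, Set.mem_iUnion]
  constructor
  · intro hf
    have h0 : f ≠ 0 := by
      rintro rfl
      exact hf fun _ _ => HahnSeries.coeff_zero
    rw [idealPow, Set.mem_ofPred_eq, ← HahnSeries.le_order_iff_forall h0] at hf
    refine ⟨(-f.order - 1).toNat, ?_, ?_⟩
    all_goals
      rw [idealPow, Set.mem_ofPred_eq, ← HahnSeries.le_order_iff_forall h0]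
      omega
  · rintro ⟨n, hn⟩ hf
    exact hn.2 (idealPow_antitone (by omega) hf)

lemma measurableSet_sphere (n : ℕ) : MeasurableSet (sphere n : Set (Khat k)) :=
  (measurableSet_idealPow _).diff (measurableSet_idealPow _)

lemma pairwise_disjoint_sphere :
    Pairwise (Function.onFun Disjoint (sphere : ℕ → Set (Khat k))) := by
  intro m n hmn
  refine Set.disjoint_left.mpr fun f hm hn => hmn ?_
  have := (absInf_eq_of_mem_sphere hm).symm.trans (absInf_eq_of_mem_sphere hn)
  have := pow_right_injective₀ (by linarith [one_lt_card (k := k)]) one_lt_card.ne' this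
  omega

lemma measure_sphere (hinv : ∀ x : Khat k, Measure.map (fun y => x + y) μ = μ)
    (hO : μ (Oball k) = 1) (n : ℕ) :
    μ (sphere n) = ENNReal.ofReal ((Fintype.card k : ℝ) ^ n * (Fintype.card k - 1)) := by
  rw [sphere, measure_sdiff (idealPow_antitone (by omega))
    (measurableSet_idealPow _).nullMeasurableSet, measure_idealPow hinv hO,
    measure_idealPow hinv hO]
  · rw [neg_neg, neg_neg, zpow_natCast, show ((n : ℤ) + 1) = ((n + 1 : ℕ) : ℤ) by norm_cast,
      zpow_natCast, pow_succ, mul_sub, mul_one, ENNReal.ofReal_sub _ (by positivity),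
      ENNReal.ofReal_mul (by positivity), ENNReal.ofReal_pow (by positivity),
      ENNReal.ofReal_natCast]
  · rw [measure_idealPow hinv hO]
    exact (ENNReal.zpow_lt_top card_ne_zero_ennreal (ENNReal.natCast_ne_top _) _).ne

/-- The total mass of the density `q²/|ξ₋|²_∞` on `J`. -/
lemma setLIntegral_compl_idealPow_zero
    (hinv : ∀ x : Khat k, Measure.map (fun y => x + y) μ = μ) (hO : μ (Oball k) = 1) :
    ∫⁻ f in (idealPow 0)ᶜ, ENNReal.ofReal ((Fintype.card k : ℝ) ^ 2 * ((absInf f) ^ 2)⁻¹) ∂μ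
      = Fintype.card k := by
  have hq := one_lt_card (k := k)
  have hq0 : (0 : ℝ) < Fintype.card k := by linarith
  have hterm : ∀ n : ℕ,
      ∫⁻ f in sphere n, ENNReal.ofReal ((Fintype.card k : ℝ) ^ 2 * ((absInf f) ^ 2)⁻¹) ∂μ
        = ENNReal.ofReal (((Fintype.card k : ℝ) - 1) * (Fintype.card k : ℝ)⁻¹ ^ n) := by
    intro n
    rw [setLIntegral_congr_fun (measurableSet_sphere n)
      (g := fun _ => ENNReal.ofReal ((Fintype.card k : ℝ) ^ 2 *
        (((Fintype.card k : ℝ) ^ (n + 1)) ^ 2)⁻¹))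
      (fun f hf => by simp only [absInf_eq_of_mem_sphere hf]),
      setLIntegral_const, measure_sphere hinv hO, ← ENNReal.ofReal_mul (by positivity)]
    congr 1
    rw [inv_pow]
    field_simp
    ring
  have hgeom : HasSum (fun n : ℕ => ((Fintype.card k : ℝ) - 1) * (Fintype.card k : ℝ)⁻¹ ^ n)
      (Fintype.card k) := by
    have h := (hasSum_geometric_of_lt_one (inv_nonneg.mpr hq0.le) (inv_lt_one_of_one_lt₀ hq)).mul_left
      ((Fintype.card k : ℝ) - 1)
    have hne : (Fintype.card k : ℝ) - 1 ≠ 0 := by linarith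
    have hval : ((Fintype.card k : ℝ) - 1) * (1 - (Fintype.card k : ℝ)⁻¹)⁻¹ = Fintype.card k := by
      rw [← one_div (Fintype.card k : ℝ), one_sub_div hq0.ne', inv_div, mul_div_cancel₀ _ hne]
    rwa [hval] at h
  rw [compl_idealPow_zero_eq, lintegral_iUnion measurableSet_sphere pairwise_disjoint_sphere,
    tsum_congr hterm, ← ENNReal.ofReal_tsum_of_nonneg _ hgeom.summable, hgeom.tsum_eq,
    ENNReal.ofReal_natCast]
  exact fun n => mul_nonneg (by linarith) (by positivity)

end Measure

lemma absInf_sub_of_mem {f g : Khat k} (hf : f ∉ idealPow 0) (hg : g ∈ idealPow 1) :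
    absInf (g - f) = absInf f := by
  have h1 : absInf g < absInf f := by
    have hg' := absInf_le_zpow_iff.mpr (idealPow_antitone zero_le_one hg)
    exact hg'.trans_lt (lt_of_not_ge fun h => hf (absInf_le_zpow_iff.mp h))
  refine le_antisymm ?_ ?_
  · have := absInf_add_le g (-f)
    rwa [absInf_neg, max_eq_right h1.le, ← sub_eq_add_neg] at this
  · by_contra! hlt
    have := absInf_add_le g (-(g - f))
    rw [absInf_neg, ← sub_eq_add_neg, sub_sub_cancel] at this
    exact (max_lt h1 hlt).not_ge this

variable (k)

/-- The pushforward of `m̂` under the second projection equals `q` times the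
restriction of the Haar measure `μ` to `X⁻¹O ∩ ᶜK`. -/
theorem statement_14 (k : Type*) [Field k] [Fintype k] (μ : MeasureTheory.Measure (Khat k))
    (hinv : ∀ x : Khat k, MeasureTheory.Measure.map (fun y => x + y) μ = μ)
    (hO : μ (Oball k) = 1) :
    MeasureTheory.Measure.map (Prod.snd : Khat k × Khat k → Khat k) (mhat k μ)
      = (Fintype.card k : ℝ≥0∞) • μ.restrict (XinvO k ∩ cK k) := by
  have := sigmaFinite_of_translation_invariant hinv hO
  set F : Khat k → ℝ≥0∞ :=
    fun f => ENNReal.ofReal ((Fintype.card k : ℝ) ^ 2 * ((absInf f) ^ 2)⁻¹)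
  have hFmeas : Measurable F :=
    (measurable_const.mul (measurable_absInf.pow_const 2).inv).ennreal_ofReal
  have hJ : MeasurableSet (Jset k) := by
    rw [Jset_eq]
    exact (measurableSet_idealPow 0).compl
  have hX : MeasurableSet (XinvO k) := by
    rw [XinvO_eq]
    exact measurableSet_idealPow 1
  have hΩ : MeasurableSet (OmegaSet k) :=
    (hJ.inter measurableSet_cK).prod (hX.inter measurableSet_cK)
  have hdens : dens k =ᵐ[(μ.prod μ).restrict (OmegaSet k)] fun p => F p.1 := by
    filter_upwards [ae_restrict_mem hΩ] with p hp
    have h1 := hp.1.1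
    have h2 := hp.2.1
    rw [Jset_eq] at h1
    rw [XinvO_eq] at h2
    rw [dens, absInf_sub_of_mem h1 h2]
  have hae : (Jset k ∩ cK k : Set (Khat k)) =ᵐ[μ] Jset k :=
    inter_ae_eq_left_of_ae_eq_univ (ae_eq_univ.mpr (by
      rw [cK, compl_compl]
      exact measure_Kset_eq_zero hinv hO))
  rw [mhat, restrict_withDensity hΩ, withDensity_congr_ae hdens, OmegaSet,
    ← Measure.prod_restrict, ← prod_withDensity_left hFmeas, Measure.map_snd_prod,
    withDensity_apply _ MeasurableSet.univ, Measure.restrict_univ,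
    Measure.restrict_congr_set hae, Jset_eq, setLIntegral_compl_idealPow_zero hinv hO]

end ArtinCoding
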